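/- In Version B, consider a nonempty position in which every pile has size at most 3, with a₁ piles of size 1, a₂ piles of size 2, and a₃ piles of size 3. It is a P-position if and only if (a₁, a₂, a₃) satisfies one of: (1) a₁ even, a₂ ≥ 1, a₃ = 0; (2) a₁ odd, a₂ odd, a₃ = 1; (3) a₁ even, a₂ odd, a₃ ≥ 2. -/

import Mathlib

/-- Remove one token from a pile of size `p` in `G`: delete one copy of `p` and,
if `p ≠ 1`, add back a pile of size `p - 1`. -/
def takeOne (G : Multiset ℕ) (p : ℕ) : Multiset ℕ :=
  G.erase p + (if p = 1 then (0 : Multiset ℕ) else {p - 1})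

/-- Legal moves of Version B: remove one token from one chosen pile, or remove
one token from every pile simultaneously (piles reaching size 0 are deleted). -/
inductive MoveB : Multiset ℕ → Multiset ℕ → Prop
  | one {G : Multiset ℕ} {p : ℕ} (hp : p ∈ G) (h1 : 1 ≤ p) : MoveB G (takeOne G p)
  | all {G : Multiset ℕ} (hG : G ≠ 0) : MoveB G ((G.map (· - 1)).filter (· ≠ 0))

mutual
  /-- P-positions of Version B under normal play: every move leads to an N-position
  (in particular the empty position is a P-position).  Since every move strictly
  decreases the total number of tokens, this inductive definition agrees with the
  usual recursive definition of outcome classes. -/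
  inductive PPosB : Multiset ℕ → Prop
    | mk : ∀ {G : Multiset ℕ}, (∀ H, MoveB G H → NPosB H) → PPosB G
  /-- N-positions of Version B under normal play: some move leads to a P-position. -/
  inductive NPosB : Multiset ℕ → Prop
    | mk : ∀ {G H : Multiset ℕ}, MoveB G H → PPosB H → NPosB G
end

/-- The position with `a` piles of size `1`, `b` piles of size `2` and `c` piles of size `3`. -/
def pilesLeThree (a b c : ℕ) : Multiset ℕ :=
  Multiset.replicate a 1 + Multiset.replicate b 2 + Multiset.replicate c 3

theorem takeOne_cons (p : ℕ) (G : Multiset ℕ) :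
    takeOne (p ::ₘ G) p = G + (if p = 1 then (0 : Multiset ℕ) else {p - 1}) := by
  simp [takeOne]

theorem pilesLeThree_succ_one (a b c : ℕ) :
    pilesLeThree (a + 1) b c = 1 ::ₘ pilesLeThree a b c := by
  simp [pilesLeThree, Multiset.replicate_succ]

theorem pilesLeThree_succ_two (a b c : ℕ) :
    pilesLeThree a (b + 1) c = 2 ::ₘ pilesLeThree a b c := by
  simp [pilesLeThree, Multiset.replicate_succ]

theorem pilesLeThree_succ_three (a b c : ℕ) :
    pilesLeThree a b (c + 1) = 3 ::ₘ pilesLeThree a b c := by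
  simp [pilesLeThree, Multiset.replicate_succ]

theorem takeOne_pilesLeThree_one (a b c : ℕ) :
    takeOne (pilesLeThree (a + 1) b c) 1 = pilesLeThree a b c := by
  rw [pilesLeThree_succ_one, takeOne_cons]
  simp

theorem takeOne_pilesLeThree_two (a b c : ℕ) :
    takeOne (pilesLeThree a (b + 1) c) 2 = pilesLeThree (a + 1) b c := by
  rw [pilesLeThree_succ_two, takeOne_cons, pilesLeThree_succ_one, ← Multiset.singleton_add,
    add_comm]
  simp

theorem takeOne_pilesLeThree_three (a b c : ℕ) :
    takeOne (pilesLeThree a b (c + 1)) 3 = pilesLeThree a (b + 1) c := by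
  rw [pilesLeThree_succ_three, takeOne_cons, pilesLeThree_succ_two, ← Multiset.singleton_add,
    add_comm]
  simp

theorem pred_all_pilesLeThree (a b c : ℕ) :
    ((pilesLeThree a b c).map (· - 1)).filter (· ≠ 0) = pilesLeThree b c 0 := by
  have h (n k : ℕ) : (Multiset.replicate n (k + 1)).filter (· ≠ 0) =
      Multiset.replicate n (k + 1) :=
    Multiset.filter_eq_self.2 fun x hx => by simp [Multiset.eq_of_mem_replicate hx]
  have h0 : (Multiset.replicate a 0).filter (· ≠ 0) = 0 :=
    Multiset.filter_eq_nil.2 fun x hx => by simp [Multiset.eq_of_mem_replicate hx]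
  simp only [pilesLeThree, Multiset.map_add, Multiset.map_replicate, Multiset.filter_add,
    Nat.sub_self, Nat.reduceSub, h0, h b 0, h c 1, zero_add, Multiset.replicate_zero, add_zero]

theorem pilesLeThree_ne_zero {a b c : ℕ} : pilesLeThree a b c ≠ 0 ↔ a + b + c ≠ 0 := by
  rw [← Multiset.card_pos, pilesLeThree]
  simp only [Multiset.card_add, Multiset.card_replicate]
  omega

/-- The Version B moves from a position with all piles of size at most three. -/
theorem moveB_pilesLeThree_iff {a b c : ℕ} {H : Multiset ℕ} :
    MoveB (pilesLeThree a b c) H ↔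
      (∃ a', a = a' + 1 ∧ H = pilesLeThree a' b c) ∨
      (∃ b', b = b' + 1 ∧ H = pilesLeThree (a + 1) b' c) ∨
      (∃ c', c = c' + 1 ∧ H = pilesLeThree a (b + 1) c') ∨
      (a + b + c ≠ 0 ∧ H = pilesLeThree b c 0) := by
  constructor
  · intro h
    generalize hG : pilesLeThree a b c = G at h
    cases h with
    | @one p hp _ =>
      subst hG
      have hp' := hp
      simp only [pilesLeThree, Multiset.mem_add, Multiset.mem_replicate] at hp'
      rcases hp' with (⟨h, rfl⟩ | ⟨h, rfl⟩) | ⟨h, rfl⟩ <;>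
        obtain ⟨n, rfl⟩ := Nat.exists_eq_succ_of_ne_zero h
      · exact .inl ⟨n, rfl, takeOne_pilesLeThree_one n b c⟩
      · exact .inr (.inl ⟨n, rfl, takeOne_pilesLeThree_two a n c⟩)
      · exact .inr (.inr (.inl ⟨n, rfl, takeOne_pilesLeThree_three a b n⟩))
    | all h =>
      subst hG
      exact .inr (.inr (.inr ⟨pilesLeThree_ne_zero.1 h, pred_all_pilesLeThree a b c⟩))
  · rintro (⟨n, rfl, rfl⟩ | ⟨n, rfl, rfl⟩ | ⟨n, rfl, rfl⟩ | ⟨h, rfl⟩)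
    · rw [← takeOne_pilesLeThree_one n b c]
      exact .one (by simp [pilesLeThree_succ_one]) (by norm_num)
    · rw [← takeOne_pilesLeThree_two a n c]
      exact .one (by simp [pilesLeThree_succ_two]) (by norm_num)
    · rw [← takeOne_pilesLeThree_three a b n]
      exact .one (by simp [pilesLeThree_succ_three]) (by norm_num)
    · rw [← pred_all_pilesLeThree a]
      exact .all (pilesLeThree_ne_zero.2 h)

/-- The P-positions of Version B with all piles of size at most three, the empty one included. -/
def IsPTriple (a b c : ℕ) : Prop :=
  a + b + c = 0 ∨ (Even a ∧ 1 ≤ b ∧ c = 0) ∨ (Odd a ∧ Odd b ∧ c = 1) ∨ (Even a ∧ Odd b ∧ 2 ≤ c)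

theorem not_isPTriple_of_moveB {a b c : ℕ} (h : IsPTriple a b c) {H : Multiset ℕ}
    (hH : MoveB (pilesLeThree a b c) H) :
    ∃ a' b' c', H = pilesLeThree a' b' c' ∧ a' + 2 * b' + 3 * c' < a + 2 * b + 3 * c ∧
      ¬ IsPTriple a' b' c' := by
  simp only [IsPTriple, Nat.even_iff, Nat.odd_iff] at h ⊢
  rcases moveB_pilesLeThree_iff.1 hH with
    ⟨n, rfl, rfl⟩ | ⟨n, rfl, rfl⟩ | ⟨n, rfl, rfl⟩ | ⟨h0, rfl⟩ <;>
  exact ⟨_, _, _, rfl, by omega, by omega⟩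

theorem exists_moveB_isPTriple {a b c : ℕ} (h : ¬ IsPTriple a b c) :
    ∃ a' b' c', MoveB (pilesLeThree a b c) (pilesLeThree a' b' c') ∧
      a' + 2 * b' + 3 * c' < a + 2 * b + 3 * c ∧ IsPTriple a' b' c' := by
  have h0 : a + b + c ≠ 0 := fun h0 => h (.inl h0)
  simp only [IsPTriple, Nat.even_iff, Nat.odd_iff] at h ⊢
  by_cases hall : (b = 0 ∧ c = 0) ∨ (b % 2 = 0 ∧ 1 ≤ c ∧ (c = 1 → a % 2 = 1))
  · exact ⟨b, c, 0, moveB_pilesLeThree_iff.2 (.inr (.inr (.inr ⟨h0, rfl⟩))), by omega, by omega⟩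
  by_cases hc : c = 1
  · subst hc
    exact ⟨a, b + 1, 0, moveB_pilesLeThree_iff.2 (.inr (.inr (.inl ⟨0, rfl, rfl⟩))), by omega,
      by omega⟩
  · obtain ⟨n, rfl⟩ : ∃ n, a = n + 1 := Nat.exists_eq_succ_of_ne_zero (by omega)
    exact ⟨n, b, c, moveB_pilesLeThree_iff.2 (.inl ⟨n, rfl, rfl⟩), by omega, by omega⟩

theorem outcome_pilesLeThree (a b c : ℕ) :
    (IsPTriple a b c → PPosB (pilesLeThree a b c) ∧ ¬ NPosB (pilesLeThree a b c)) ∧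
      (¬ IsPTriple a b c → NPosB (pilesLeThree a b c) ∧ ¬ PPosB (pilesLeThree a b c)) := by
  induction hn : a + 2 * b + 3 * c using Nat.strong_induction_on generalizing a b c with
  | _ n ih =>
    subst hn
    refine ⟨fun h => ?_, fun h => ?_⟩
    · have hN {H : Multiset ℕ} (hH : MoveB (pilesLeThree a b c) H) : NPosB H ∧ ¬ PPosB H := by
        obtain ⟨a', b', c', rfl, hlt, h'⟩ := not_isPTriple_of_moveB h hH
        exact (ih _ hlt a' b' c' rfl).2 h'
      exact ⟨.mk fun H hH => (hN hH).1, fun ⟨hH, hP⟩ => (hN hH).2 hP⟩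
    · obtain ⟨a', b', c', hmove, hlt, h'⟩ := exists_moveB_isPTriple h
      obtain ⟨hP, hN⟩ := (ih _ hlt a' b' c' rfl).1 h'
      exact ⟨.mk hmove hP, fun ⟨hall⟩ => hN (hall _ hmove)⟩


/-- In Version B, the classification of nonempty P-positions in which every pile has
size at most 3, with `a1` piles of size 1, `a2` piles of size 2 and `a3` piles of
size 3. -/
theorem versionB_piles_le_three (a1 a2 a3 : ℕ) (hne : a1 + a2 + a3 ≠ 0) :
    PPosB (Multiset.replicate a1 1 + Multiset.replicate a2 2 + Multiset.replicate a3 3) ↔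
      (Even a1 ∧ 1 ≤ a2 ∧ a3 = 0) ∨
      (Odd a1 ∧ Odd a2 ∧ a3 = 1) ∨
      (Even a1 ∧ Odd a2 ∧ 2 ≤ a3) := by
  have h := outcome_pilesLeThree a1 a2 a3
  have hiff : PPosB (pilesLeThree a1 a2 a3) ↔ IsPTriple a1 a2 a3 :=
    ⟨fun hP => by_contra fun hc => (h.2 hc).2 hP, fun hc => (h.1 hc).1⟩
  exact hiff.trans (or_iff_right hne)
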